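/- arXiv:2507.08646 — 7 statements merged into one kernel-verified Lean document; each statement's English description precedes it below -/
import Mathlib

section
/- Let h ≥ 1 be an integer and let i0 be an integer with 0 ≤ i0 ≤ h−1. Let c = (h+1−i0)(h+1) and let A = {0, 1, h+1, c} ⊆ ℤ. Then |A| = 4 and |hA| = C(h+3, 3) − C(i0+2, 3), where C(n, k) denotes the binomial coefficient. -/
open Pointwise

/-- The `h`-fold sumset of a finite set of integers: `hsum 0 A = {0}`,
`hsum (n+1) A = A + hsum n A`. -/
def hsum : ℕ → Finset ℤ → Finset ℤ
  | 0, _ => {0}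
  | n + 1, A => A + hsum n A

theorem mem_hsum_iff (a b : ℤ) (n : ℕ) (v : ℤ) :
    v ∈ hsum n {0, 1, a, b} ↔ ∃ x y z : ℕ, x + y + z ≤ n ∧ v = x + a * y + b * z := by
  induction n generalizing v with
  | zero =>
    simp only [hsum, Finset.mem_singleton]
    constructor
    · rintro rfl
      exact ⟨0, 0, 0, by simp, by simp⟩
    · rintro ⟨x, y, z, hs, rfl⟩
      obtain ⟨rfl, rfl, rfl⟩ : x = 0 ∧ y = 0 ∧ z = 0 := by omega
      simp
  | succ n ih =>
    simp only [hsum, Finset.mem_add, Finset.mem_insert, Finset.mem_singleton, ih]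
    constructor
    · rintro ⟨e, he, _, ⟨x, y, z, hs, rfl⟩, rfl⟩
      rcases he with rfl | rfl | rfl | rfl
      · exact ⟨x, y, z, by omega, by ring⟩
      · exact ⟨x + 1, y, z, by omega, by push_cast; ring⟩
      · exact ⟨x, y + 1, z, by omega, by push_cast; ring⟩
      · exact ⟨x, y, z + 1, by omega, by push_cast; ring⟩
    · rintro ⟨x, y, z, hs, rfl⟩
      rcases x with _ | x
      · rcases y with _ | y
        · rcases z with _ | z
          · exact ⟨0, by simp, 0, ⟨0, 0, 0, by simp, by simp⟩, by simp⟩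
          · exact ⟨b, by simp, _, ⟨0, 0, z, by omega, rfl⟩, by push_cast; ring⟩
        · exact ⟨a, by simp, _, ⟨0, y, z, by omega, rfl⟩, by push_cast; ring⟩
      · exact ⟨1, by simp, _, ⟨x, y, z, by omega, rfl⟩, by push_cast; ring⟩

theorem add_mul_inj_of_lt {k x x' w w' : ℕ} (hx : x < k) (hx' : x' < k)
    (he : x + k * w = x' + k * w') : x = x' ∧ w = w' := by
  have hmod := congrArg (· % k) he
  have hdiv := congrArg (· / k) he
  have hk : 0 < k := by omega
  simp only [Nat.add_mul_mod_self_left, Nat.mod_eq_of_lt hx, Nat.mod_eq_of_lt hx'] at hmod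
  simp only [Nat.add_mul_div_left _ _ hk, Nat.div_eq_of_lt hx, Nat.div_eq_of_lt hx',
    zero_add] at hdiv
  exact ⟨hmod, hdiv⟩

theorem sum_range_sub_eq_choose (k : ℕ) :
    ∑ x ∈ Finset.range k, (k - x) = (k + 1).choose 2 := by
  induction k with
  | zero => rfl
  | succ k ih =>
    rw [Finset.sum_range_succ', Nat.choose_succ_succ' (k + 1) 1, ← ih]
    simp [add_comm]

theorem sum_range_choose_two_add (h m : ℕ) (hm : m ≤ h + 1) :
    ∑ y ∈ Finset.range m, (h + 1 - y + 1).choose 2 + (h + 3 - m).choose 3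
      = (h + 3).choose 3 := by
  induction m with
  | zero => simp
  | succ m ih =>
    rw [← ih (by omega), Finset.sum_range_succ, show h + 3 - m = (h + 1 - m + 1) + 1 by omega,
      Nat.choose_succ_succ' _ 2, show h + 3 - (m + 1) = h + 1 - m + 1 by omega, add_assoc]

/-- The triples `⟨y, x, z⟩` with `y < m` and `x + y + z ≤ h`. -/
def truncatedSimplex (h m : ℕ) : Finset (Σ _ : ℕ, Σ _ : ℕ, ℕ) :=
  (Finset.range m).sigma fun y =>
    (Finset.range (h + 1 - y)).sigma fun x => Finset.range (h + 1 - y - x)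

theorem mem_truncatedSimplex {h m : ℕ} {p : Σ _ : ℕ, Σ _ : ℕ, ℕ} :
    p ∈ truncatedSimplex h m ↔ p.1 < m ∧ p.2.1 + p.1 + p.2.2 ≤ h := by
  simp only [truncatedSimplex, Finset.mem_sigma, Finset.mem_range]
  omega

theorem card_truncatedSimplex_add (h m : ℕ) (hm : m ≤ h + 1) :
    (truncatedSimplex h m).card + (h + 3 - m).choose 3 = (h + 3).choose 3 := by
  simp only [truncatedSimplex, Finset.card_sigma, Finset.card_range, sum_range_sub_eq_choose]
  exact sum_range_choose_two_add h m hm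

theorem hsum_eq_image_truncatedSimplex (h m : ℕ) (hm : 1 ≤ m) :
    hsum h {0, 1, (h : ℤ) + 1, (m : ℤ) * ((h : ℤ) + 1)} =
      (truncatedSimplex h m).image
        fun p => ((p.2.1 + (h + 1) * (p.1 + m * p.2.2) : ℕ) : ℤ) := by
  ext v
  simp only [mem_hsum_iff, Finset.mem_image, mem_truncatedSimplex]
  constructor
  · rintro ⟨x, y, z, hs, rfl⟩
    have hy := Nat.mod_add_div y m
    have hle : y / m ≤ m * (y / m) := Nat.le_mul_of_pos_left _ hm
    refine ⟨⟨y % m, x, y / m + z⟩, ⟨Nat.mod_lt _ hm, ?_⟩, ?_⟩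
    · dsimp only
      omega
    · dsimp only
      rw [mul_add m, ← add_assoc (y % m), hy]
      push_cast
      ring
  · rintro ⟨⟨y, x, z⟩, ⟨-, hs⟩, rfl⟩
    exact ⟨x, y, z, hs, by push_cast; ring⟩

theorem card_hsum_add_choose (h m : ℕ) (hm : 1 ≤ m) (hmh : m ≤ h + 1) :
    (hsum h {0, 1, (h : ℤ) + 1, (m : ℤ) * ((h : ℤ) + 1)}).card + (h + 3 - m).choose 3
      = (h + 3).choose 3 := by
  rw [hsum_eq_image_truncatedSimplex h m hm, Finset.card_image_of_injOn,
    card_truncatedSimplex_add h m hmh]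
  rintro ⟨y, x, z⟩ hp ⟨y', x', z'⟩ hp' he
  rw [Finset.mem_coe, mem_truncatedSimplex] at hp hp'
  dsimp only at hp hp' he
  obtain ⟨rfl, hw⟩ := add_mul_inj_of_lt (by omega) (by omega) (Int.ofNat_inj.mp he)
  obtain ⟨rfl, rfl⟩ := add_mul_inj_of_lt hp.1 hp'.1 hw
  rfl

theorem stmt_0 (h : ℕ) (hh : 1 ≤ h) (i0 : ℕ) (hi0 : i0 ≤ h - 1)
    (c : ℤ) (hc : c = ((h : ℤ) + 1 - (i0 : ℤ)) * ((h : ℤ) + 1))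
    (A : Finset ℤ) (hA : A = {0, 1, (h : ℤ) + 1, c}) :
    A.card = 4 ∧ (hsum h A).card = Nat.choose (h + 3) 3 - Nat.choose (i0 + 2) 3 := by
  obtain ⟨m, hm⟩ : ∃ m, m + i0 = h + 1 := ⟨h + 1 - i0, by omega⟩
  have hcm : c = (m : ℤ) * ((h : ℤ) + 1) := by
    rw [hc, show (h : ℤ) + 1 - i0 = m by omega]
  subst hA
  constructor
  · have hlt : (h : ℤ) + 1 < c := by
      have : (2 : ℤ) ≤ m := by omega
      nlinarith
    rw [Finset.card_insert_of_notMem, Finset.card_insert_of_notMem,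
      Finset.card_insert_of_notMem, Finset.card_singleton] <;>
    · simp only [Finset.mem_insert, Finset.mem_singleton]
      omega
  · have hcard := card_hsum_add_choose h m (by omega) (by omega)
    rw [show h + 3 - m = i0 + 2 by omega, ← hcm] at hcard
    omega
end

section
/- Let h ≥ 2 and k ≥ 2 be integers and let A be a finite set of integers with |A| = k. Then |hA| = h(k−1) + 1 if and only if A is an arithmetic progression of length k, i.e., there exist integers a and d with d ≠ 0 such that A = {a, a+d, a+2d, …, a+(k−1)d}. -/
open Pointwise

theorem hsum_nonempty {A : Finset ℤ} (hA : A.Nonempty) (n : ℕ) : (hsum n A).Nonempty := by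
  induction n with
  | zero => exact Finset.singleton_nonempty 0
  | succ n ih => exact hA.add ih

theorem hsum_two (A : Finset ℤ) : hsum 2 A = A + A := by
  rw [hsum, hsum, hsum, Finset.singleton_zero, add_zero]

theorem card_add_self_add_le_card_hsum {A : Finset ℤ} (hA : A.Nonempty) (n : ℕ) :
    (A + A).card + n * (A.card - 1) ≤ (hsum (n + 2) A).card := by
  induction n with
  | zero => simp [hsum_two]
  | succ n ih =>
    have hle : A.card + (hsum (n + 2) A).card - 1 ≤ (A + hsum (n + 2) A).card :=
      cauchy_davenport_add_of_linearOrder_isCancelAdd hA (hsum_nonempty hA _)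
    have hpos := hA.card_pos
    change _ ≤ (A + hsum (n + 2) A).card
    rw [add_mul, one_mul]
    omega

/-- Sumsets of an arithmetic progression with `m + 1` terms are arithmetic progressions. -/
theorem hsum_image_range (a d : ℤ) (m n : ℕ) :
    hsum n ((Finset.range (m + 1)).image fun i : ℕ => a + (i : ℤ) * d) =
      (Finset.range (n * m + 1)).image fun i : ℕ => n * a + (i : ℤ) * d := by
  induction n with
  | zero => simp [hsum]
  | succ n ih =>
    rw [hsum, ih]
    ext x
    simp only [Finset.mem_add, Finset.mem_image, Finset.mem_range]
    constructor
    · rintro ⟨_, ⟨i, hi, rfl⟩, _, ⟨j, hj, rfl⟩, rfl⟩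
      refine ⟨i + j, ?_, by push_cast; ring⟩
      rw [add_mul, one_mul]
      omega
    · rintro ⟨s, hs, rfl⟩
      rw [add_mul, one_mul] at hs
      refine ⟨_, ⟨min s m, by omega, rfl⟩, _, ⟨s - min s m, by omega, rfl⟩, ?_⟩
      rw [Nat.cast_sub (min_le_left s m)]
      push_cast
      ring

/-- A set of `n + 2` integers whose doubling is as small as possible is an increasing
arithmetic progression. -/
theorem exists_eq_image_range_of_card_add_self_le (n : ℕ) (A : Finset ℤ) (hA : A.card = n + 2)
    (hAA : (A + A).card ≤ 2 * n + 3) :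
    ∃ a d : ℤ, 0 < d ∧ A = (Finset.range (n + 2)).image fun i : ℕ => a + (i : ℤ) * d := by
  induction n generalizing A with
  | zero =>
    obtain ⟨x, y, hxy, rfl⟩ := Finset.card_eq_two.mp hA
    rcases lt_or_gt_of_ne hxy with hlt | hlt
    · exact ⟨x, y - x, by omega, by simp [Finset.range_add_one, Finset.pair_comm]⟩
    · exact ⟨y, x - y, by omega, by simp [Finset.range_add_one]⟩
  | succ n ih =>
    have hne : A.Nonempty := Finset.card_pos.mp (by omega)
    obtain ⟨m, hmA, hm⟩ := A.exists_max_image id hne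
    set B := A.erase m with hB
    have hBA : B ⊆ A := Finset.erase_subset _ _
    have hBcard : B.card = n + 2 := by rw [hB, Finset.card_erase_of_mem hmA]; omega
    have hBne : B.Nonempty := Finset.card_pos.mp (by omega)
    have hBm : ∀ x ∈ B, x < m := fun x hx =>
      lt_of_le_of_ne (hm x (hBA hx)) (Finset.ne_of_mem_erase hx)
    obtain ⟨p, hpB, hp⟩ := B.exists_max_image id hBne
    simp only [id] at hp
    have hpm := hBm p hpB
    have hle : ∀ z ∈ B + B, z ≤ p + p := by
      intro z hz
      obtain ⟨x, hx, y, hy, rfl⟩ := Finset.mem_add.mp hz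
      exact add_le_add (hp x hx) (hp y hy)
    have hmm : m + m ∉ insert (m + p) (B + B) := by
      rw [Finset.mem_insert, not_or]
      exact ⟨by omega, fun hz => by have := hle _ hz; omega⟩
    have hmp : m + p ∉ B + B := fun hz => by have := hle _ hz; omega
    have hcard : (insert (m + m) (insert (m + p) (B + B))).card = (B + B).card + 2 := by
      rw [Finset.card_insert_of_notMem hmm, Finset.card_insert_of_notMem hmp]
    have hsub : insert (m + m) (insert (m + p) (B + B)) ⊆ A + A := by
      simp only [Finset.insert_subset_iff]
      exact ⟨Finset.add_mem_add hmA hmA, Finset.add_mem_add hmA (hBA hpB),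
        Finset.add_subset_add hBA hBA⟩
    have hlower : B.card + B.card - 1 ≤ (B + B).card :=
      cauchy_davenport_add_of_linearOrder_isCancelAdd hBne hBne
    have heq : insert (m + m) (insert (m + p) (B + B)) = A + A :=
      Finset.eq_of_subset_of_card_le hsub (by omega)
    have hle' := Finset.card_le_card hsub
    obtain ⟨a, d, hd, hBeq⟩ := ih B hBcard (by omega)
    have hlast : a + ((n + 1 : ℕ) : ℤ) * d ∈ B := by
      rw [hBeq]; exact Finset.mem_image_of_mem _ (by simp)
    have hprev : a + (n : ℤ) * d ∈ B := by
      rw [hBeq]; exact Finset.mem_image_of_mem _ (by simp)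
    have hlast_le := hp _ hlast
    have hlast_lt := hBm _ hlast
    have hprev_lt := hBm _ hprev
    push_cast at hlast_le hlast_lt
    have hmem : m + (a + (n : ℤ) * d) ∈ insert (m + m) (insert (m + p) (B + B)) := by
      rw [heq]; exact Finset.add_mem_add hmA (hBA hprev)
    have hmeq : m = a + ((n + 2 : ℕ) : ℤ) * d := by
      rcases Finset.mem_insert.mp hmem with h | h
      · omega
      rcases Finset.mem_insert.mp h with h | h
      · nlinarith
      rw [hBeq] at h
      simp only [Finset.mem_add, Finset.mem_image, Finset.mem_range] at h
      obtain ⟨_, ⟨i, hi, rfl⟩, _, ⟨j, hj, rfl⟩, hij⟩ := h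
      have hmt : m = a + ((i : ℤ) + j - n) * d := by linarith
      have hgt : (n : ℤ) + 1 < (i : ℤ) + j - n := by
        refine lt_of_mul_lt_mul_right ?_ hd.le
        linarith
      rw [hmt]
      congr 2
      push_cast
      omega
    refine ⟨a, d, hd, ?_⟩
    rw [Finset.range_add_one, Finset.image_insert, ← hmeq, ← hBeq, hB, Finset.insert_erase hmA]

theorem stmt_3 (h k : ℕ) (hh : 2 ≤ h) (hk : 2 ≤ k)
    (A : Finset ℤ) (hA : A.card = k) :
    (hsum h A).card = h * (k - 1) + 1 ↔
      ∃ a d : ℤ, d ≠ 0 ∧ A = (Finset.range k).image (fun i : ℕ => a + (i : ℤ) * d) := by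
  constructor
  · intro hcard
    obtain ⟨n, rfl⟩ := Nat.exists_eq_add_of_le' hh
    obtain ⟨j, rfl⟩ := Nat.exists_eq_add_of_le' hk
    have hle := card_add_self_add_le_card_hsum (Finset.card_pos.mp (by omega : 0 < A.card)) n
    rw [hcard, hA, add_mul] at hle
    obtain ⟨a, d, hd, hAeq⟩ := exists_eq_image_range_of_card_add_self_le j A hA (by omega)
    exact ⟨a, d, hd.ne', hAeq⟩
  · rintro ⟨a, d, hd, rfl⟩
    obtain ⟨m, rfl⟩ := Nat.exists_eq_add_of_le' (one_le_two.trans hk)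
    rw [hsum_image_range, Finset.card_image_of_injective, Finset.card_range, Nat.add_sub_cancel]
    intro i j hij
    simpa [hd] using hij
end

section
/- Let h ≥ 2 be an integer and let A = {0, 1, h+1, (h+1)²} ⊆ ℤ. Then A is a B_h-set and |hA| = C(h+3, 3). -/
open Pointwise

/-- `A` is a `B_h`-set: any two multisets of `h` elements of `A` with the same
sum are equal (unique representation up to permutation of the summands). -/
def IsBhSet (h : ℕ) (A : Finset ℤ) : Prop :=
  ∀ m₁ m₂ : Multiset ℤ, (∀ x ∈ m₁, x ∈ A) → (∀ x ∈ m₂, x ∈ A) →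
    Multiset.card m₁ = h → Multiset.card m₂ = h → m₁.sum = m₂.sum → m₁ = m₂

/-- The `n`-fold sumset consists of the sums of the multisets of `n` elements of `A`. -/
theorem mem_hsum_iff_s7 {n : ℕ} {A : Finset ℤ} {x : ℤ} :
    x ∈ hsum n A ↔ ∃ m : Multiset ℤ, (∀ a ∈ m, a ∈ A) ∧ Multiset.card m = n ∧ m.sum = x := by
  induction n generalizing x with
  | zero =>
    simp only [hsum, Finset.mem_singleton, Multiset.card_eq_zero]
    constructor
    · rintro rfl
      exact ⟨0, by simp⟩
    · rintro ⟨m, -, rfl, rfl⟩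
      simp
  | succ n ih =>
    simp only [hsum, Finset.mem_add, ih]
    constructor
    · rintro ⟨a, ha, _, ⟨m, hm, rfl, rfl⟩, rfl⟩
      exact ⟨a ::ₘ m, by simpa using ⟨ha, hm⟩, by simp, by simp⟩
    · rintro ⟨m, hm, hcard, rfl⟩
      obtain ⟨a, ham⟩ := Multiset.card_pos_iff_exists_mem.1 (by omega : 0 < Multiset.card m)
      obtain ⟨t, rfl⟩ := Multiset.exists_cons_of_mem ham
      simp only [Multiset.mem_cons, forall_eq_or_imp] at hm
      exact ⟨_, hm.1, _, ⟨_, hm.2, by simpa using hcard, rfl⟩, by simp⟩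

theorem hsum_eq_image_sym (n : ℕ) (A : Finset ℤ) :
    hsum n A = (A.sym n).image fun m : Sym ℤ n => (m : Multiset ℤ).sum := by
  ext x
  simp only [mem_hsum_iff_s7, Finset.mem_image, Finset.mem_sym_iff]
  constructor
  · rintro ⟨m, hm, hcard, hx⟩
    exact ⟨⟨m, hcard⟩, hm, hx⟩
  · rintro ⟨m, hm, hx⟩
    exact ⟨m, hm, m.2, hx⟩

theorem card_finset_sym {α : Type*} [DecidableEq α] (s : Finset α) (n : ℕ) :
    (s.sym n).card = Nat.multichoose s.card n := by
  conv_lhs => rw [← Finset.attach_map_val (s := s)]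
  rw [Finset.sym_map, Finset.card_map, Finset.attach_eq_univ, Finset.sym_univ,
    Finset.card_univ, Sym.card_sym_eq_multichoose, Fintype.card_coe]

/-- A `B_h`-set has the largest possible `h`-fold sumset. -/
theorem IsBhSet.card_hsum {h : ℕ} {A : Finset ℤ} (hA : IsBhSet h A) :
    (hsum h A).card = Nat.multichoose A.card h := by
  rw [hsum_eq_image_sym, Finset.card_image_of_injOn, card_finset_sym]
  intro m₁ h₁ m₂ h₂ hsum_eq
  exact Sym.coe_injective (hA m₁ m₂ (Finset.mem_sym_iff.1 h₁) (Finset.mem_sym_iff.1 h₂)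
    m₁.2 m₂.2 hsum_eq)

theorem exists_eq_replicate_add {α : Type*} [DecidableEq α] {a b c d : α} (m : Multiset α)
    (hm : ∀ x ∈ m, x ∈ ({a, b, c, d} : Finset α)) :
    ∃ i j k l : ℕ, m = Multiset.replicate i a + Multiset.replicate j b +
      Multiset.replicate k c + Multiset.replicate l d := by
  induction m using Multiset.induction_on with
  | empty => exact ⟨0, 0, 0, 0, by simp⟩
  | cons x m ih =>
    simp only [Multiset.mem_cons, forall_eq_or_imp] at hm
    obtain ⟨i, j, k, l, rfl⟩ := ih hm.2
    have hx := hm.1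
    simp only [Finset.mem_insert, Finset.mem_singleton] at hx
    rcases hx with rfl | rfl | rfl | rfl
    · exact ⟨i + 1, j, k, l, by simp [Multiset.replicate_succ]⟩
    · exact ⟨i, j + 1, k, l, by simp [Multiset.replicate_succ]⟩
    · exact ⟨i, j, k + 1, l, by simp [Multiset.replicate_succ]⟩
    · exact ⟨i, j, k, l + 1, by simp [Multiset.replicate_succ]⟩

/-- Uniqueness of the lowest digit in base `h + 1`. -/
theorem digit_unique {h b b' q q' : ℕ} (hb : b ≤ h) (hb' : b' ≤ h)
    (heq : b + (h + 1) * q = b' + (h + 1) * q') : b = b' ∧ q = q' := by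
  have hbb : b = b' := by
    have hmod := congrArg (· % (h + 1)) heq
    simpa [Nat.add_mul_mod_self_left, Nat.mod_eq_of_lt (Nat.lt_succ_of_le hb),
      Nat.mod_eq_of_lt (Nat.lt_succ_of_le hb')] using hmod
  subst hbb
  exact ⟨rfl, Nat.eq_of_mul_eq_mul_left h.succ_pos (Nat.add_left_cancel heq)⟩

theorem isBhSet_zero_one_base_sq (h : ℕ) :
    IsBhSet h {0, 1, (h : ℤ) + 1, ((h : ℤ) + 1) ^ 2} := by
  intro m₁ m₂ h₁ h₂ c₁ c₂ hs
  obtain ⟨i, j, k, l, rfl⟩ := exists_eq_replicate_add m₁ h₁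
  obtain ⟨i', j', k', l', rfl⟩ := exists_eq_replicate_add m₂ h₂
  simp only [Multiset.card_add, Multiset.card_replicate] at c₁ c₂
  simp only [Multiset.sum_add, Multiset.sum_replicate, nsmul_eq_mul] at hs
  have hnat : j + (h + 1) * (k + (h + 1) * l) = j' + (h + 1) * (k' + (h + 1) * l') := by
    zify
    linear_combination hs
  obtain ⟨rfl, hkl⟩ := digit_unique (by omega) (by omega) hnat
  obtain ⟨rfl, rfl⟩ := digit_unique (by omega) (by omega) hkl
  obtain rfl : i = i' := by omega
  rfl

theorem stmt_7 (h : ℕ) (hh : 2 ≤ h)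
    (A : Finset ℤ) (hA : A = {0, 1, (h : ℤ) + 1, ((h : ℤ) + 1) ^ 2}) :
    IsBhSet h A ∧ (hsum h A).card = Nat.choose (h + 3) 3 := by
  subst hA
  have hB := isBhSet_zero_one_base_sq h
  refine ⟨hB, ?_⟩
  have hcard : ({0, 1, (h : ℤ) + 1, ((h : ℤ) + 1) ^ 2} : Finset ℤ).card = 4 := by
    have hpos : (2 : ℤ) ≤ h := by exact_mod_cast hh
    have hlt : (h : ℤ) + 1 < ((h : ℤ) + 1) ^ 2 := by nlinarith
    repeat rw [Finset.card_insert_of_notMem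
      (by simp only [Finset.mem_insert, Finset.mem_singleton]; omega)]
    rw [Finset.card_singleton]
  rw [hB.card_hsum, hcard, Nat.multichoose_eq, show 4 + h - 1 = h + 3 by omega,
    Nat.choose_symm_add]
end

section
/- Let h ≥ 1 be an integer and let B = {0, 1, h+1} ⊆ ℤ. Then B is a B_h-set, and for every integer m with 1 ≤ m ≤ h, the m-fold sumset mB satisfies |mB| = C(m+2, 2). -/
open Pointwise

/-- Uniqueness of division with remainder by `h + 1`, over the integers. -/
theorem add_mul_succ_inj {h a b a' b' : ℕ} (ha : a ≤ h) (ha' : a' ≤ h)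
    (e : (a : ℤ) + b * ((h : ℤ) + 1) = a' + b' * ((h : ℤ) + 1)) : a = a' ∧ b = b' := by
  have e' : a + b * (h + 1) = a' + b' * (h + 1) := by exact_mod_cast e
  have hb : b = b' := by
    have := congrArg (· / (h + 1)) e'
    simpa [Nat.add_mul_div_right, Nat.div_eq_of_lt (Nat.lt_succ_of_le ha),
      Nat.div_eq_of_lt (Nat.lt_succ_of_le ha')] using this
  subst hb
  exact ⟨by omega, rfl⟩

theorem Multiset.exists_replicate_of_mem_triple {α : Type*} [DecidableEq α] {x y z : α}
    (s : Multiset α) (hs : ∀ w ∈ s, w ∈ ({x, y, z} : Finset α)) :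
    ∃ i j k : ℕ, s = replicate i x + replicate j y + replicate k z := by
  induction s using Multiset.induction_on with
  | empty => exact ⟨0, 0, 0, by simp⟩
  | cons w s ih =>
    obtain ⟨i, j, k, rfl⟩ := ih fun v hv => hs v (mem_cons_of_mem hv)
    have hw := hs w (mem_cons_self _ _)
    simp only [Finset.mem_insert, Finset.mem_singleton] at hw
    rcases hw with rfl | rfl | rfl
    · exact ⟨i + 1, j, k, by simp [replicate_succ]⟩
    · exact ⟨i, j + 1, k, by simp [replicate_succ]⟩
    · exact ⟨i, j, k + 1, by simp [replicate_succ]⟩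

theorem isBhSet_zero_one_succ (h : ℕ) : IsBhSet h {0, 1, (h : ℤ) + 1} := by
  intro s t hs ht cs ct e
  obtain ⟨i, j, k, rfl⟩ := s.exists_replicate_of_mem_triple hs
  obtain ⟨i', j', k', rfl⟩ := t.exists_replicate_of_mem_triple ht
  simp only [Multiset.card_add, Multiset.card_replicate] at cs ct
  simp only [Multiset.sum_add, Multiset.sum_replicate, nsmul_eq_mul, mul_zero, mul_one,
    zero_add] at e
  obtain ⟨rfl, rfl⟩ := add_mul_succ_inj (by omega) (by omega) e
  obtain rfl : i = i' := by omega
  rfl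

theorem mem_hsum_zero_one_iff (q : ℤ) (m : ℕ) (x : ℤ) :
    x ∈ hsum m {0, 1, q} ↔ ∃ a b : ℕ, a + b ≤ m ∧ (a : ℤ) + b * q = x := by
  induction m generalizing x with
  | zero =>
    simp only [hsum, Finset.mem_singleton]
    constructor
    · rintro rfl
      exact ⟨0, 0, by simp⟩
    · rintro ⟨a, b, hab, rfl⟩
      obtain ⟨rfl, rfl⟩ : a = 0 ∧ b = 0 := by omega
      simp
  | succ m ih =>
    simp only [hsum, Finset.mem_add, ih, Finset.mem_insert, Finset.mem_singleton]
    constructor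
    · rintro ⟨y, rfl | rfl | rfl, z, ⟨a, b, hab, rfl⟩, rfl⟩
      · exact ⟨a, b, by omega, by ring⟩
      · exact ⟨a + 1, b, by omega, by push_cast; ring⟩
      · exact ⟨a, b + 1, by omega, by push_cast; ring⟩
    · rintro ⟨a, b, hab, rfl⟩
      rcases a with _ | a
      · rcases b with _ | b
        · exact ⟨0, by simp, 0, ⟨0, 0, by simp⟩, by simp⟩
        · exact ⟨q, by simp, _, ⟨0, b, by omega, rfl⟩, by push_cast; ring⟩
      · exact ⟨1, by simp, _, ⟨a, b, by omega, rfl⟩, by push_cast; ring⟩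

theorem card_sigma_range_succ (m : ℕ) :
    ((Finset.range (m + 1)).sigma fun n => Finset.range (n + 1)).card = (m + 2).choose 2 := by
  simp only [Finset.card_sigma, Finset.card_range]
  induction m with
  | zero => rfl
  | succ m ih => rw [Finset.sum_range_succ, ih, Nat.choose_succ_succ' (m + 2) 1]; simp; omega

theorem card_hsum_zero_one_succ {h m : ℕ} (hm : m ≤ h) :
    (hsum m {0, 1, (h : ℤ) + 1}).card = (m + 2).choose 2 := by
  rw [← card_sigma_range_succ]
  symm
  refine Finset.card_bij
    (fun p _ => ((p.1 - p.2 : ℕ) : ℤ) + (p.2 : ℤ) * ((h : ℤ) + 1)) ?_ ?_ ?_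
  · rintro ⟨n, b⟩ hp
    simp only [Finset.mem_sigma, Finset.mem_range] at hp
    exact (mem_hsum_zero_one_iff _ _ _).2 ⟨n - b, b, by omega, rfl⟩
  · rintro ⟨n, b⟩ hp ⟨n', b'⟩ hp' e
    simp only [Finset.mem_sigma, Finset.mem_range] at hp hp'
    obtain ⟨hn, rfl⟩ :=
      add_mul_succ_inj (a := n - b) (b := b) (a' := n' - b') (b' := b') (by omega) (by omega) e
    obtain rfl : n = n' := by omega
    rfl
  · intro x hx
    obtain ⟨a, b, hab, rfl⟩ := (mem_hsum_zero_one_iff _ _ _).1 hx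
    refine ⟨⟨a + b, b⟩, ?_, by simp⟩
    simp only [Finset.mem_sigma, Finset.mem_range]
    omega

theorem stmt_8 (h : ℕ) (hh : 1 ≤ h)
    (B : Finset ℤ) (hB : B = {0, 1, (h : ℤ) + 1}) :
    IsBhSet h B ∧
      ∀ m : ℕ, 1 ≤ m → m ≤ h → (hsum m B).card = Nat.choose (m + 2) 2 := by
  subst hB
  exact ⟨isBhSet_zero_one_succ h, fun m _ hm => card_hsum_zero_one_succ hm⟩
end

section
/- Let h ≥ 2 be an integer, let i0 be an integer with 1 ≤ i0 ≤ h−1, let c = (h+1−i0)(h+1), let B = {0, 1, h+1} ⊆ ℤ, and for 0 ≤ i ≤ h let L_i = (h−i)B + ic. Then for every i with 0 ≤ i ≤ h−1, max(L_i) < min(L_{i+1}) if and only if i ≥ i0. -/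
open Pointwise

/-- If `0` is the least element of `A`, then it is the least element of every `hsum n A`. -/
theorem isLeast_hsum {A : Finset ℤ} (hA : IsLeast (A : Set ℤ) 0) (n : ℕ) :
    IsLeast (hsum n A : Set ℤ) 0 := by
  induction n with
  | zero => simp [hsum]
  | succ n ih =>
    rw [← add_zero (0 : ℤ), hsum, Finset.coe_add]
    exact ⟨Set.add_mem_add hA.1 ih.1, add_mem_lowerBounds_add hA.2 ih.2⟩

/-- If `M` is the greatest element of `A`, then `n * M` is the greatest element of `hsum n A`. -/
theorem isGreatest_hsum {A : Finset ℤ} {M : ℤ} (hA : IsGreatest (A : Set ℤ) M) (n : ℕ) :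
    IsGreatest (hsum n A : Set ℤ) (n * M) := by
  induction n with
  | zero => simp [hsum]
  | succ n ih =>
    have hM : ((n + 1 : ℕ) : ℤ) * M = M + n * M := by push_cast; ring
    rw [hM, hsum, Finset.coe_add]
    exact ⟨Set.add_mem_add hA.1 ih.1, add_mem_upperBounds_add hA.2 ih.2⟩

theorem stmt_13 (h : ℕ) (hh : 2 ≤ h) (i0 : ℕ) (hi0l : 1 ≤ i0) (hi0u : i0 ≤ h - 1)
    (c : ℤ) (hc : c = ((h : ℤ) + 1 - (i0 : ℤ)) * ((h : ℤ) + 1))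
    (B : Finset ℤ) (hB : B = {0, 1, (h : ℤ) + 1})
    (L : ℕ → Finset ℤ)
    (hL : ∀ i, L i = (hsum (h - i) B).image (fun x => x + (i : ℤ) * c)) :
    ∀ i : ℕ, i ≤ h - 1 →
      ∀ (h₁ : (L i).Nonempty) (h₂ : (L (i + 1)).Nonempty),
        ((L i).max' h₁ < (L (i + 1)).min' h₂ ↔ i0 ≤ i) := by
  intro i hi h₁ h₂
  have hmin : IsLeast (B : Set ℤ) 0 := by
    subst hB
    refine ⟨by simp, fun x hx => ?_⟩
    simp only [Finset.coe_insert, Finset.coe_singleton, Set.mem_insert_iff,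
      Set.mem_singleton_iff] at hx
    omega
  have hmax : IsGreatest (B : Set ℤ) ((h : ℤ) + 1) := by
    subst hB
    refine ⟨by simp, fun x hx => ?_⟩
    simp only [Finset.coe_insert, Finset.coe_singleton, Set.mem_insert_iff,
      Set.mem_singleton_iff] at hx
    omega
  have mono (d : ℤ) : Monotone fun x : ℤ => x + d := fun _ _ hxy => by simpa using hxy
  have hmaxL : (L i).max' h₁ = ((h - i : ℕ) : ℤ) * ((h : ℤ) + 1) + i * c := by
    refine ((L i).isGreatest_max' h₁).unique ?_
    rw [hL, Finset.coe_image]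
    exact (mono _).map_isGreatest (isGreatest_hsum hmax _)
  have hminL : (L (i + 1)).min' h₂ = 0 + ((i + 1 : ℕ) : ℤ) * c := by
    refine ((L (i + 1)).isLeast_min' h₂).unique ?_
    rw [hL, Finset.coe_image]
    exact (mono _).map_isLeast (isLeast_hsum hmin _)
  have hpos : (0 : ℤ) < (h : ℤ) + 1 := by positivity
  calc (L i).max' h₁ < (L (i + 1)).min' h₂
      ↔ ((h - i : ℕ) : ℤ) * ((h : ℤ) + 1) < ((h : ℤ) + 1 - i0) * ((h : ℤ) + 1) := by
        rw [hmaxL, hminL, ← hc]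
        push_cast
        constructor <;> intro hlt <;> linarith
    _ ↔ ((h - i : ℕ) : ℤ) < (h : ℤ) + 1 - i0 := mul_lt_mul_iff_left₀ hpos
    _ ↔ i0 ≤ i := by omega
end

section
/- Let h ≥ 2 be an integer, let i0 be an integer with 1 ≤ i0 ≤ h−1, let c = (h+1−i0)(h+1), let B = {0, 1, h+1} ⊆ ℤ, and for 0 ≤ i ≤ h let L_i = (h−i)B + ic. Then the sets L_{i0}, L_{i0+1}, …, L_h are pairwise disjoint, and consequently |⋃_{i=i0+1}^{h} L_i| = Σ_{i=i0+1}^{h} C(h−i+2, 2). -/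
open Pointwise

theorem mem_hsum_zero_one (m : ℤ) (n : ℕ) (x : ℤ) :
    x ∈ hsum n {0, 1, m} ↔ ∃ a b : ℕ, a + b ≤ n ∧ x = a + b * m := by
  induction n generalizing x with
  | zero =>
    simp only [hsum, Finset.mem_singleton]
    constructor
    · rintro rfl
      exact ⟨0, 0, by simp⟩
    · rintro ⟨a, b, hab, rfl⟩
      obtain ⟨rfl, rfl⟩ : a = 0 ∧ b = 0 := by omega
      simp
  | succ n ih =>
    simp only [hsum, Finset.mem_add, Finset.mem_insert, Finset.mem_singleton, ih]
    constructor
    · rintro ⟨y, hy, z, ⟨a, b, hab, rfl⟩, rfl⟩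
      rcases hy with rfl | rfl | rfl
      · exact ⟨a, b, by omega, by ring⟩
      · exact ⟨a + 1, b, by omega, by push_cast; ring⟩
      · exact ⟨a, b + 1, by omega, by push_cast; ring⟩
    · rintro ⟨a, b, hab, rfl⟩
      rcases a with _ | a
      · rcases b with _ | b
        · exact ⟨0, by simp, 0, ⟨0, 0, by simp⟩, by simp⟩
        · exact ⟨m, by simp, b * m, ⟨0, b, by omega, by simp⟩, by push_cast; ring⟩
      · exact ⟨1, by simp, a + b * m, ⟨a, b, by omega, rfl⟩, by push_cast; ring⟩

theorem eq_and_eq_of_add_mul_eq {m a a' u u' : ℤ} (ha : 0 ≤ a) (ham : a < m)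
    (ha' : 0 ≤ a') (ham' : a' < m) (h : a + u * m = a' + u' * m) : a = a' ∧ u = u' := by
  have hm : 0 < m := by omega
  have key : a = a' := by
    have := congrArg (· % m) h
    simpa [Int.emod_eq_of_lt ha ham, Int.emod_eq_of_lt ha' ham'] using this
  refine ⟨key, ?_⟩
  subst key
  exact mul_right_cancel₀ hm.ne' (add_left_cancel h)

theorem card_hsum_zero_one {m : ℤ} {n : ℕ} (hnm : (n : ℤ) < m) :
    (hsum n {0, 1, m}).card = (n + 2).choose 2 := by
  have himage : hsum n {0, 1, m} =
      ((Finset.range (n + 1)).sigma fun k => Finset.HasAntidiagonal.antidiagonal k).image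
        (fun p => (p.2.1 : ℤ) + p.2.2 * m) := by
    ext x
    simp only [mem_hsum_zero_one, Finset.mem_image, Finset.mem_sigma, Finset.mem_range,
      Finset.HasAntidiagonal.mem_antidiagonal]
    constructor
    · rintro ⟨a, b, hab, rfl⟩
      exact ⟨⟨a + b, a, b⟩, ⟨by simp only; omega, rfl⟩, rfl⟩
    · rintro ⟨⟨k, a, b⟩, ⟨hk, hab⟩, rfl⟩
      exact ⟨a, b, by simp only at hk hab; omega, rfl⟩
  have hcard (n : ℕ) : ∑ k ∈ Finset.range (n + 1), (k + 1) = (n + 2).choose 2 := by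
    induction n with
    | zero => rfl
    | succ n ih =>
      rw [Finset.sum_range_succ, ih, Nat.choose_succ_succ' (n + 2) 1, Nat.choose_one_right]
      ring
  rw [himage, Finset.card_image_of_injOn, Finset.card_sigma]
  · simpa using hcard n
  · rintro ⟨k, a, b⟩ hp ⟨k', a', b'⟩ hq heq
    simp only [Finset.coe_sigma, Set.mem_sigma_iff, Finset.mem_coe, Finset.mem_range,
      Finset.HasAntidiagonal.mem_antidiagonal] at hp hq heq
    obtain ⟨h1, h2⟩ := eq_and_eq_of_add_mul_eq (by omega) (by omega) (by omega) (by omega) heq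
    obtain ⟨rfl, rfl⟩ : a = a' ∧ b = b' := by omega
    obtain rfl : k = k' := by omega
    rfl

theorem stmt_14 (h : ℕ) (hh : 2 ≤ h) (i0 : ℕ) (hi0l : 1 ≤ i0) (hi0u : i0 ≤ h - 1)
    (c : ℤ) (hc : c = ((h : ℤ) + 1 - (i0 : ℤ)) * ((h : ℤ) + 1))
    (B : Finset ℤ) (hB : B = {0, 1, (h : ℤ) + 1})
    (L : ℕ → Finset ℤ)
    (hL : ∀ i, L i = (hsum (h - i) B).image (fun x => x + (i : ℤ) * c)) :
    (∀ i j : ℕ, i0 ≤ i → i ≤ h → i0 ≤ j → j ≤ h → i ≠ j → Disjoint (L i) (L j)) ∧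
      ((Finset.Icc (i0 + 1) h).biUnion L).card =
        ∑ i ∈ Finset.Icc (i0 + 1) h, Nat.choose (h - i + 2) 2 := by
  subst hB hc
  have hdisj : ∀ i j : ℕ, i0 ≤ i → i ≤ h → i0 ≤ j → j ≤ h → i ≠ j →
      Disjoint (L i) (L j) := by
    intro i j hi hih hj hjh hij
    rw [Finset.disjoint_left]
    intro x hxi hxj
    simp only [hL, Finset.mem_image, mem_hsum_zero_one] at hxi hxj
    obtain ⟨_, ⟨a, b, hab, rfl⟩, rfl⟩ := hxi
    obtain ⟨_, ⟨a', b', hab', rfl⟩, heq⟩ := hxj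
    obtain ⟨-, hdigit⟩ := eq_and_eq_of_add_mul_eq (m := (h : ℤ) + 1) (a := a') (a' := a)
      (u := b' + j * ((h : ℤ) + 1 - i0)) (u' := b + i * ((h : ℤ) + 1 - i0))
      (by omega) (by omega) (by omega) (by omega) (by linear_combination heq)
    have := (eq_and_eq_of_add_mul_eq (by omega) (by omega) (by omega) (by omega) hdigit).2
    omega
  refine ⟨hdisj, ?_⟩
  rw [Finset.card_biUnion]
  · refine Finset.sum_congr rfl fun i _ => ?_
    rw [hL, Finset.card_image_of_injective _ (add_left_injective _),
      card_hsum_zero_one (by omega)]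
  · intro i hi j hj hij
    rw [Finset.mem_coe, Finset.mem_Icc] at hi hj
    exact hdisj i j (by omega) hi.2 (by omega) hj.2 hij
end

section
/- There exists no set A of integers with |A| = 3 and |3A| = 8. Consequently, R_Z(3, 3) = {7, 9, 10}. -/
open Pointwise

/-- `RZ h k` is the set of `h`-fold sumset sizes of `k`-element sets of integers. -/
def RZ (h k : ℕ) : Set ℕ :=
  {n : ℕ | ∃ A : Finset ℤ, A.card = k ∧ (hsum h A).card = n}

theorem exists_arith_form_of_card_eq_three {A : Finset ℤ} (hA : A.card = 3) :
    ∃ a p q : ℤ, 0 < p ∧ 0 < q ∧ A = {a, a + p, a + p + q} := by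
  obtain ⟨x, y, z, hxy, hxz, hyz, rfl⟩ := Finset.card_eq_three.mp hA
  have of_lt : ∀ a b c : ℤ, a < b → b < c → ({x, y, z} : Finset ℤ) = {a, b, c} →
      ∃ a p q : ℤ, 0 < p ∧ 0 < q ∧ ({x, y, z} : Finset ℤ) = {a, a + p, a + p + q} := by
    intro a b c hab hbc h
    refine ⟨a, b - a, c - b, by omega, by omega, ?_⟩
    rw [h]
    congr 2 <;> [skip; congr 1] <;> omega
  rcases lt_or_gt_of_ne hxy with h₁ | h₁ <;> rcases lt_or_gt_of_ne hxz with h₂ | h₂ <;>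
    rcases lt_or_gt_of_ne hyz with h₃ | h₃
  · exact of_lt x y z h₁ h₃ rfl
  · exact of_lt x z y h₂ h₃ (by grind)
  · omega
  · exact of_lt z x y h₂ h₁ (by grind)
  · exact of_lt y x z h₁ h₂ (by grind)
  · omega
  · exact of_lt y z x h₃ h₂ (by grind)
  · exact of_lt z y x h₃ h₁ (by grind)

theorem hsum_three_triple (a p q : ℤ) :
    hsum 3 {a, a + p, a + p + q} =
      {3 * a, 3 * a + p, 3 * a + 2 * p, 3 * a + 3 * p, 3 * a + p + q, 3 * a + 2 * p + q,
        3 * a + 3 * p + q, 3 * a + 2 * p + 2 * q, 3 * a + 3 * p + 2 * q,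
        3 * a + 3 * p + 3 * q} := by
  ext x
  simp only [hsum, Finset.mem_add, Finset.mem_insert, Finset.mem_singleton]
  constructor
  · rintro ⟨u, hu, _, ⟨v, hv, _, ⟨w, hw, _, rfl, rfl⟩, rfl⟩, rfl⟩
    omega
  · have of_sum : ∀ u v w : ℤ, (u = a ∨ u = a + p ∨ u = a + p + q) →
        (v = a ∨ v = a + p ∨ v = a + p + q) → (w = a ∨ w = a + p ∨ w = a + p + q) →
        x = u + v + w → ∃ u, (u = a ∨ u = a + p ∨ u = a + p + q) ∧ ∃ s,
          (∃ v, (v = a ∨ v = a + p ∨ v = a + p + q) ∧ ∃ t,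
            (∃ w, (w = a ∨ w = a + p ∨ w = a + p + q) ∧ ∃ z, z = 0 ∧ w + z = t) ∧
              v + t = s) ∧ u + s = x :=
      fun u v w hu hv hw h =>
        ⟨u, hu, _, ⟨v, hv, _, ⟨w, hw, 0, rfl, rfl⟩, rfl⟩, by omega⟩
    rintro (h | h | h | h | h | h | h | h | h | h)
    · exact of_sum a a a (by simp) (by simp) (by simp) (by omega)
    · exact of_sum a a (a + p) (by simp) (by simp) (by simp) (by omega)
    · exact of_sum a (a + p) (a + p) (by simp) (by simp) (by simp) (by omega)
    · exact of_sum (a + p) (a + p) (a + p) (by simp) (by simp) (by simp) (by omega)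
    · exact of_sum a a (a + p + q) (by simp) (by simp) (by simp) (by omega)
    · exact of_sum a (a + p) (a + p + q) (by simp) (by simp) (by simp) (by omega)
    · exact of_sum (a + p) (a + p) (a + p + q) (by simp) (by simp) (by simp) (by omega)
    · exact of_sum a (a + p + q) (a + p + q) (by simp) (by simp) (by simp) (by omega)
    · exact of_sum (a + p) (a + p + q) (a + p + q) (by simp) (by simp) (by simp) (by omega)
    · exact of_sum (a + p + q) (a + p + q) (a + p + q) (by simp) (by simp) (by simp) (by omega)

set_option maxHeartbeats 1600000 in
theorem card_hsum_three_triple {a p q : ℤ} (hp : 0 < p) (hq : 0 < q) :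
    (hsum 3 {a, a + p, a + p + q}).card =
      if q = p then 7 else if q = 2 * p ∨ p = 2 * q then 9 else 10 := by
  rw [hsum_three_triple]
  split_ifs with h₁ h₂
  · subst h₁
    trans ({3 * a, 3 * a + q, 3 * a + 2 * q, 3 * a + 3 * q, 3 * a + 4 * q, 3 * a + 5 * q,
      3 * a + 6 * q} : Finset ℤ).card
    · congr 1
      ext x
      simp only [Finset.mem_insert, Finset.mem_singleton]
      constructor <;> intro h <;> omega
    · repeat rw [Finset.card_insert_of_notMem
        (by simp only [Finset.mem_insert, Finset.mem_singleton]; omega)]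
      rw [Finset.card_singleton]
  · rcases h₂ with rfl | rfl
    · trans ({3 * a, 3 * a + p, 3 * a + 2 * p, 3 * a + 3 * p, 3 * a + 4 * p, 3 * a + 5 * p,
        3 * a + 6 * p, 3 * a + 7 * p, 3 * a + 9 * p} : Finset ℤ).card
      · congr 1
        ext x
        simp only [Finset.mem_insert, Finset.mem_singleton]
        constructor <;> intro h <;> omega
      · repeat rw [Finset.card_insert_of_notMem
          (by simp only [Finset.mem_insert, Finset.mem_singleton]; omega)]
        rw [Finset.card_singleton]
    · trans ({3 * a, 3 * a + 2 * q, 3 * a + 3 * q, 3 * a + 4 * q, 3 * a + 5 * q, 3 * a + 6 * q,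
        3 * a + 7 * q, 3 * a + 8 * q, 3 * a + 9 * q} : Finset ℤ).card
      · congr 1
        ext x
        simp only [Finset.mem_insert, Finset.mem_singleton]
        constructor <;> intro h <;> omega
      · repeat rw [Finset.card_insert_of_notMem
          (by simp only [Finset.mem_insert, Finset.mem_singleton]; omega)]
        rw [Finset.card_singleton]
  · repeat rw [Finset.card_insert_of_notMem
      (by simp only [Finset.mem_insert, Finset.mem_singleton]; omega)]
    rw [Finset.card_singleton]

theorem stmt_19 :
    (¬ ∃ A : Finset ℤ, A.card = 3 ∧ (hsum 3 A).card = 8) ∧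
      RZ 3 3 = {7, 9, 10} := by
  have card_mem : ∀ A : Finset ℤ, A.card = 3 →
      (hsum 3 A).card = 7 ∨ (hsum 3 A).card = 9 ∨ (hsum 3 A).card = 10 := by
    intro A hA
    obtain ⟨a, p, q, hp, hq, rfl⟩ := exists_arith_form_of_card_eq_three hA
    rw [card_hsum_three_triple hp hq]
    split_ifs <;> simp
  refine ⟨fun ⟨A, hA, h⟩ => by have := card_mem A hA; omega, ?_⟩
  ext n
  simp only [RZ, Set.mem_ofPred_eq, Set.mem_insert_iff, Set.mem_singleton_iff]
  constructor
  · rintro ⟨A, hA, rfl⟩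
    exact card_mem A hA
  · rintro (rfl | rfl | rfl)
    · exact ⟨{0, 1, 2}, by decide, by decide⟩
    · exact ⟨{0, 1, 3}, by decide, by decide⟩
    · exact ⟨{0, 1, 4}, by decide, by decide⟩
end
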